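/- arXiv:cs/0409057 — 2 statements merged into one kernel-verified Lean document; each statement's English description precedes it below -/
import Mathlib

section
/- There is a universal constant c > 0 such that the following holds. Let (M,d) be a finite metric space with doubling constant λ ≥ 2, let r > 0 and 0 < ε ≤ 1. Then there exist a positive integer d₁ ≤ (2/ε)^{c·log₂ λ} and a map φ : M → ℝ^{d₁} such that for all x, y ∈ M: (i) ‖φ(x) − φ(y)‖_∞ ≤ min(r, d(x,y)); and (ii) if (1+ε)·r ≤ d(x,y) < 2r then ‖φ(x) − φ(y)‖_∞ ≥ (1−ε)·r. -/
/-- A finite metric space `M` has doubling constant `lam` if for every `x ∈ M` and `r > 0`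
there are at most `lam` points whose closed balls of radius `r/2` cover the closed ball
`B(x,r)`. -/
def IsDoubling (M : Type*) [MetricSpace M] (lam : ℝ) : Prop :=
  ∀ (x : M) (r : ℝ), 0 < r → ∃ s : Finset M, (s.card : ℝ) ≤ lam ∧
    ∀ y : M, dist x y ≤ r → ∃ z ∈ s, dist z y ≤ r / 2

theorem IsDoubling.exists_finset_cover {M : Type*} [MetricSpace M] {lam : ℝ}
    (h : IsDoubling M lam) (h0 : 0 ≤ lam) (k : ℕ) (x : M) {R : ℝ} (hR : 0 < R) :
    ∃ s : Finset M, (s.card : ℝ) ≤ lam ^ k ∧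
      ∀ y : M, dist x y ≤ R → ∃ z ∈ s, dist z y ≤ R / 2 ^ k := by
  classical
  induction k with
  | zero => exact ⟨{x}, by simp, fun y hy => ⟨x, by simp, by simpa using hy⟩⟩
  | succ k ih =>
    obtain ⟨s, hs, hc⟩ := ih
    choose t ht htc using fun z : M => h z (R / 2 ^ k) (by positivity)
    refine ⟨s.biUnion t, ?_, fun y hy => ?_⟩
    · calc ((s.biUnion t).card : ℝ) ≤ ∑ z ∈ s, ((t z).card : ℝ) := by
            exact_mod_cast Finset.card_biUnion_le
        _ ≤ ∑ _z ∈ s, lam := Finset.sum_le_sum fun z _ => ht z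
        _ = s.card * lam := by simp
        _ ≤ lam ^ k * lam := by gcongr
        _ = lam ^ (k + 1) := (pow_succ _ _).symm
    · obtain ⟨z, hz, hzy⟩ := hc y hy
      obtain ⟨w, hw, hwy⟩ := htc z y hzy
      exact ⟨w, Finset.mem_biUnion.2 ⟨z, hz, hw⟩, by rwa [pow_succ, ← div_div]⟩

theorem Finset.exists_separated_net {M : Type*} [MetricSpace M] {δ : ℝ} (hδ : 0 ≤ δ)
    (S : Finset M) :
    ∃ N : Finset M, (∀ z ∈ N, ∀ w ∈ N, z ≠ w → δ < dist z w) ∧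
      ∀ x ∈ S, ∃ z ∈ N, dist x z ≤ δ := by
  classical
  induction S using Finset.induction_on with
  | empty => exact ⟨∅, by simp, by simp⟩
  | insert a S _ ih =>
    obtain ⟨N, hN, hc⟩ := ih
    by_cases ha : ∃ z ∈ N, dist a z ≤ δ
    · exact ⟨N, hN, fun x hx => (Finset.mem_insert.1 hx).elim (fun e => e ▸ ha) (hc x)⟩
    · push Not at ha
      refine ⟨insert a N, fun z hz w hw hzw => ?_, fun x hx => ?_⟩
      · rcases Finset.mem_insert.1 hz with hza | hz' <;>
      rcases Finset.mem_insert.1 hw with hwa | hw'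
        · exact absurd (hza.trans hwa.symm) hzw
        · exact hza ▸ ha w hw'
        · rw [dist_comm, hwa]; exact ha z hz'
        · exact hN z hz' w hw' hzw
      · rcases Finset.mem_insert.1 hx with rfl | hx
        · exact ⟨x, by simp, by simpa using hδ⟩
        · obtain ⟨z, hz, h⟩ := hc x hx
          exact ⟨z, Finset.mem_insert_of_mem hz, h⟩

/-- Greedy colouring of a finite set of points in which every closed ball of radius `R` contains
at most `K` points of the set. -/
theorem Finset.exists_coloring_of_card_ball_le {M : Type*} [MetricSpace M] {R : ℝ} (hR : 0 ≤ R)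
    {K : ℕ} (hK : 0 < K) (N : Finset M)
    (hN : ∀ z ∈ N, ∀ B ⊆ N, (∀ w ∈ B, dist z w ≤ R) → B.card ≤ K) :
    ∃ f : M → Fin K, ∀ z ∈ N, ∀ w ∈ N, z ≠ w → f z = f w → R < dist z w := by
  classical
  induction N using Finset.induction_on with
  | empty => exact ⟨fun _ => ⟨0, hK⟩, by simp⟩
  | insert a N haN ih =>
    obtain ⟨f, hf⟩ := ih fun z hz B hB =>
      hN z (Finset.mem_insert_of_mem hz) B (hB.trans (Finset.subset_insert a N))
    set A := N.filter fun w => dist a w ≤ R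
    have haA : a ∉ A := fun h => haN (Finset.mem_filter.1 h).1
    have hA : A.card < K := by
      have := hN a (by simp) (insert a A)
        (Finset.insert_subset_insert a (Finset.filter_subset _ _)) (by simp [A, hR])
      rw [Finset.card_insert_of_notMem haA] at this
      omega
    obtain ⟨c, -, hc⟩ := Finset.exists_mem_notMem_of_card_lt_card
      (s := A.image f) (t := Finset.univ)
      (by simpa using Finset.card_image_le.trans_lt hA)
    have key : ∀ w ∈ N, f w = c → R < dist a w := fun w hw h => by
      by_contra! hlt
      exact hc (Finset.mem_image.2 ⟨w, Finset.mem_filter.2 ⟨hw, hlt⟩, h⟩)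
    have hne : ∀ w ∈ N, w ≠ a := fun w hw e => haN (e ▸ hw)
    refine ⟨Function.update f a c, fun z hz w hw hzw h => ?_⟩
    rcases Finset.mem_insert.1 hz with hza | hz' <;>
      rcases Finset.mem_insert.1 hw with hwa | hw'
    · exact absurd (hza.trans hwa.symm) hzw
    · rw [hza, Function.update_self, Function.update_of_ne (hne w hw')] at h
      exact hza ▸ key w hw' h.symm
    · rw [hwa, Function.update_self, Function.update_of_ne (hne z hz')] at h
      rw [dist_comm, hwa]
      exact key z hz' h
    · rw [Function.update_of_ne (hne w hw'), Function.update_of_ne (hne z hz')] at h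
      exact hf z hz' w hw' hzw h

theorem IsDoubling.card_le_of_separated {M : Type*} [MetricSpace M] {lam : ℝ}
    (h : IsDoubling M lam) (h0 : 0 ≤ lam) {k : ℕ} {x : M} {R δ : ℝ} (hR : 0 < R)
    (hk : 2 * (R / 2 ^ k) ≤ δ) (B : Finset M) (hB : ∀ w ∈ B, dist x w ≤ R)
    (hsep : ∀ z ∈ B, ∀ w ∈ B, z ≠ w → δ < dist z w) : (B.card : ℝ) ≤ lam ^ k := by
  obtain ⟨s, hs, hc⟩ := h.exists_finset_cover h0 k x hR
  refine le_trans ?_ hs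
  choose! g hg hgd using fun y (hy : y ∈ B) => hc y (hB y hy)
  have : B.card ≤ s.card := by
    refine Finset.card_le_card_of_injOn g hg fun z hz w hw hzw => ?_
    by_contra hne
    have h1 := hsep z hz w hw hne
    have h2 := hgd z hz
    have h3 := hgd w hw
    rw [← hzw] at h3
    have h4 := dist_triangle_left z w (g z)
    linarith
  exact_mod_cast this

theorem exists_two_pow_between {ε : ℝ} (hε : 0 < ε) (hε1 : ε ≤ 1) {lam : ℝ} (hlam : 2 ≤ lam) :
    ∃ k : ℕ, 8 / ε ≤ 2 ^ k ∧ lam ^ k ≤ (2 / ε) ^ (4 * Real.logb 2 lam) := by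
  obtain ⟨n, hn, hn'⟩ := exists_nat_pow_near (x := 8 / ε) (y := (2 : ℝ))
    (by rw [le_div_iff₀ hε]; linarith) (by norm_num)
  refine ⟨n + 1, hn'.le, ?_⟩
  have hlog : 0 ≤ Real.logb 2 lam := Real.logb_nonneg (by norm_num) (by linarith)
  have hb : (2 : ℝ) ^ (n + 1) ≤ (2 / ε) ^ 4 := by
    have h1 : 1 ≤ 1 / ε := by rw [le_div_iff₀ hε]; linarith
    have h2 : 1 / ε ≤ (1 / ε) ^ 4 := le_self_pow₀ h1 (by norm_num)
    calc (2 : ℝ) ^ (n + 1) = 2 ^ n * 2 := pow_succ _ _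
      _ ≤ 8 / ε * 2 := by gcongr
      _ = 16 * (1 / ε) := by ring
      _ ≤ 16 * (1 / ε) ^ 4 := by gcongr
      _ = (2 / ε) ^ 4 := by ring
  calc lam ^ (n + 1) = ((2 : ℝ) ^ Real.logb 2 lam) ^ (n + 1) := by
        rw [Real.rpow_logb (by norm_num) (by norm_num) (by linarith)]
    _ = ((2 : ℝ) ^ (n + 1)) ^ Real.logb 2 lam := by
        rw [← Real.rpow_natCast, ← Real.rpow_natCast, ← Real.rpow_mul (by norm_num),
          ← Real.rpow_mul (by norm_num), mul_comm]
    _ ≤ ((2 / ε) ^ 4) ^ Real.logb 2 lam := Real.rpow_le_rpow (by positivity) hb hlog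
    _ = (2 / ε) ^ (4 * Real.logb 2 lam) := by
        rw [Real.rpow_mul (by positivity)]
        norm_cast

theorem Metric.abs_min_infDist_sub_le {M : Type*} [MetricSpace M] {r : ℝ} (hr : 0 ≤ r)
    (C : Set M) (x y : M) :
    |min r (Metric.infDist x C) - min r (Metric.infDist y C)| ≤ min r (dist x y) := by
  have hx : 0 ≤ min r (Metric.infDist x C) := le_min hr Metric.infDist_nonneg
  have hy : 0 ≤ min r (Metric.infDist y C) := le_min hr Metric.infDist_nonneg
  refine le_min (abs_sub_le_iff.2 ⟨?_, ?_⟩) ((abs_min_sub_min_le_max _ _ _ _).trans ?_)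
  · linarith [min_le_left r (Metric.infDist x C)]
  · linarith [min_le_left r (Metric.infDist y C)]
  · simp only [sub_self, abs_zero, max_le_iff, dist_nonneg, true_and]
    rw [← Real.dist_eq]
    simpa using (Metric.lipschitz_infDist_pt C).dist_le_mul x y

theorem stmt11 :
    ∃ c : ℝ, 0 < c ∧
      ∀ (M : Type) [MetricSpace M] [Fintype M] (lam : ℝ),
        IsDoubling M lam → 2 ≤ lam →
        ∀ r ε : ℝ, 0 < r → 0 < ε → ε ≤ 1 →
        ∃ (d₁ : ℕ) (φ : M → (Fin d₁ → ℝ)),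
          0 < d₁ ∧ (d₁ : ℝ) ≤ (2 / ε) ^ (c * Real.logb 2 lam) ∧
          ∀ x y : M,
            ‖φ x - φ y‖ ≤ min r (dist x y) ∧
            ((1 + ε) * r ≤ dist x y → dist x y < 2 * r → (1 - ε) * r ≤ ‖φ x - φ y‖) := by
  refine ⟨4, by norm_num, fun M _ _ lam hM hlam r ε hr hε hε1 => ?_⟩
  have h0 : 0 ≤ lam := by linarith
  obtain ⟨k, hk, hkl⟩ := exists_two_pow_between hε hε1 hlam
  have hK : 0 < ⌊lam ^ k⌋₊ := Nat.floor_pos.2 (one_le_pow₀ (by linarith))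
  obtain ⟨N, hsep, hnet⟩ := Finset.exists_separated_net (mul_pos hε hr).le (Finset.univ : Finset M)
  have hkδ : 2 * (4 * r / 2 ^ k) ≤ ε * r := by
    rw [div_le_iff₀ hε] at hk
    rw [← mul_div_assoc, div_le_iff₀ (by positivity)]
    nlinarith
  obtain ⟨f, hf⟩ := N.exists_coloring_of_card_ball_le (R := 4 * r) (by linarith) hK
    fun z _ B hB hBd => Nat.le_floor <|
      hM.card_le_of_separated h0 (by linarith) hkδ B hBd
        fun z hz w hw => hsep z (hB hz) w (hB hw)
  refine ⟨_, fun x i => min r (Metric.infDist x {z | z ∈ N ∧ f z = i}), hK,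
    (Nat.floor_le (by positivity)).trans hkl, fun x y => ⟨?_, fun hxy hxy' => ?_⟩⟩
  · exact (pi_norm_le_iff_of_nonneg (le_min hr.le dist_nonneg)).2 fun i =>
      Metric.abs_min_infDist_sub_le hr.le _ x y
  · obtain ⟨z, hz, hxz⟩ := hnet x (Finset.mem_univ x)
    refine le_trans ?_ (norm_le_pi_norm _ (f z))
    have hzC : z ∈ {w | w ∈ N ∧ f w = f z} := ⟨hz, rfl⟩
    have hx : Metric.infDist x {w | w ∈ N ∧ f w = f z} ≤ ε * r :=
      (Metric.infDist_le_dist_of_mem hzC).trans hxz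
    have hy : r ≤ Metric.infDist y {w | w ∈ N ∧ f w = f z} := by
      refine (Metric.le_infDist ⟨z, hzC⟩).2 ?_
      rintro w ⟨hw, hwz⟩
      rcases eq_or_ne w z with rfl | hne
      · linarith [dist_triangle_right x y w]
      · have h1 := hf w hw z hz hne hwz
        have h2 := dist_triangle4 w y x z
        rw [dist_comm w y, dist_comm y x] at h2
        nlinarith
    rw [Pi.sub_apply, Real.norm_eq_abs, abs_sub_comm]
    beta_reduce
    rw [min_eq_left hy]
    refine le_trans ?_ (le_abs_self _)
    linarith [min_le_right r (Metric.infDist x {w | w ∈ N ∧ f w = f z})]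
end

section
/- There is a universal constant c > 0 such that the following holds (Assouad's embedding theorem for the 1/2-snowflake). Let (M,d) be a finite metric space with doubling constant λ ≥ 2 and let 0 < ε ≤ 1/2. Then there exist a positive integer D ≤ (2/ε)^{c·log₂ λ} and a map φ : M → ℝ^{D} such that for all x, y ∈ M: (1−ε)·√(d(x,y)) ≤ ‖φ(x) − φ(y)‖_∞ ≤ (1+ε)·√(d(x,y)). -/
/-- Iterating the doubling property `n` times. -/
theorem IsDoubling.exists_cover {M : Type*} [MetricSpace M] {lam : ℝ} (h : IsDoubling M lam)
    (hlam : 0 ≤ lam) (n : ℕ) (x : M) {r : ℝ} (hr : 0 < r) :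
    ∃ s : Finset M, (s.card : ℝ) ≤ lam ^ n ∧
      ∀ y : M, dist x y ≤ r → ∃ z ∈ s, dist z y ≤ r / 2 ^ n := by
  classical
  induction n with
  | zero => exact ⟨{x}, by simp, fun y hy => ⟨x, by simp, by simpa using hy⟩⟩
  | succ n ih =>
    obtain ⟨s, hs, hcov⟩ := ih
    choose f hf hfc using fun z : M => h z (r / 2 ^ n) (by positivity)
    refine ⟨s.biUnion f, ?_, fun y hy => ?_⟩
    · calc ((s.biUnion f).card : ℝ) ≤ ∑ z ∈ s, ((f z).card : ℝ) := by
            exact_mod_cast Finset.card_biUnion_le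
        _ ≤ ∑ _z ∈ s, lam := Finset.sum_le_sum fun z _ => hf z
        _ = s.card * lam := by simp
        _ ≤ lam ^ n * lam := by gcongr
        _ = lam ^ (n + 1) := by ring
    · obtain ⟨z, hz, hzy⟩ := hcov y hy
      obtain ⟨w, hw, hwy⟩ := hfc z y hzy
      refine ⟨w, Finset.mem_biUnion.2 ⟨z, hz, hw⟩, hwy.trans_eq ?_⟩
      rw [pow_succ, div_div]

/-- Separated subsets of a ball in a doubling space are small. -/
theorem IsDoubling.card_le_of_separated_s12 {M : Type*} [MetricSpace M] {lam : ℝ}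
    (h : IsDoubling M lam) (hlam : 0 ≤ lam) (n : ℕ) (x : M) {r a : ℝ} (hr : 0 < r)
    (hra : 2 * r ≤ a * 2 ^ n) (T : Finset M) (hT : ∀ y ∈ T, dist x y ≤ r)
    (hsep : ∀ y ∈ T, ∀ z ∈ T, y ≠ z → a < dist y z) : (T.card : ℝ) ≤ lam ^ n := by
  obtain ⟨s, hs, hcov⟩ := h.exists_cover hlam n x hr
  choose! f hf hfd using fun y hy => hcov y (hT y hy)
  refine le_trans ?_ hs
  have : T.card ≤ s.card := by
    refine Finset.card_le_card_of_injOn f (fun y hy => hf y hy) fun y hy z hz hyz => ?_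
    by_contra hne
    have h1 := hsep y hy z hz hne
    have h2 := hfd y hy
    have h3 := hfd z hz
    rw [← hyz] at h3
    have h4 := dist_triangle_left y z (f y)
    have h5 : r / 2 ^ n + r / 2 ^ n ≤ a := by
      rw [← add_div, div_le_iff₀ (by positivity)]
      linarith
    linarith
  exact_mod_cast this

/-- Greedy colouring. -/
theorem exists_coloring_of_card_lt {α : Type*} (adj : α → α → Prop)
    (hsymm : ∀ p q, adj p q → adj q p) [DecidableRel adj] {K : ℕ} (hK : 0 < K) (S : Finset α)
    (hS : ∀ p ∈ S, (S.filter (adj p)).card < K) :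
    ∃ χ : α → Fin K, ∀ p ∈ S, ∀ q ∈ S, p ≠ q → adj p q → χ p ≠ χ q := by
  classical
  induction S using Finset.induction_on with
  | empty => exact ⟨fun _ => ⟨0, hK⟩, by simp⟩
  | insert p S hp ih =>
    obtain ⟨χ, hχ⟩ := ih fun q hq =>
      (Finset.card_le_card (Finset.filter_subset_filter _ (Finset.subset_insert p S))).trans_lt
        (hS q (Finset.mem_insert_of_mem hq))
    have hcard : ((S.filter (adj p)).image χ).card < (Finset.univ : Finset (Fin K)).card := by
      rw [Finset.card_univ, Fintype.card_fin]
      exact (Finset.card_image_le.trans (Finset.card_le_card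
        (Finset.filter_subset_filter _ (Finset.subset_insert p S)))).trans_lt
        (hS p (Finset.mem_insert_self p S))
    obtain ⟨c, -, hc⟩ := Finset.exists_mem_notMem_of_card_lt_card hcard
    have hc' : ∀ q ∈ S, adj p q → χ q ≠ c := fun q hq hpq hqc =>
      hc (Finset.mem_image.2 ⟨q, Finset.mem_filter.2 ⟨hq, hpq⟩, hqc⟩)
    have hne : ∀ q ∈ S, q ≠ p := fun q hq hqp => hp (hqp ▸ hq)
    refine ⟨Function.update χ p c, fun q hq q' hq' hqq' hadj => ?_⟩
    rcases Finset.mem_insert.1 hq with rfl | hqS <;>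
      rcases Finset.mem_insert.1 hq' with rfl | hqS'
    · exact absurd rfl hqq'
    · rw [Function.update_self, Function.update_of_ne (hne _ hqS')]
      exact (hc' _ hqS' hadj).symm
    · rw [Function.update_self, Function.update_of_ne (hne _ hqS)]
      exact hc' _ hqS (hsymm _ _ hadj)
    · rw [Function.update_of_ne (hne _ hqS), Function.update_of_ne (hne _ hqS')]
      exact hχ _ hqS _ hqS' hqq' hadj

/-- A finite metric space contains a maximal `a`-separated set. -/
theorem exists_finset_net (M : Type*) [MetricSpace M] [Fintype M] {a : ℝ} (ha : 0 ≤ a) :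
    ∃ S : Finset M, (∀ p ∈ S, ∀ q ∈ S, p ≠ q → a < dist p q) ∧
      ∀ x, ∃ p ∈ S, dist x p ≤ a := by
  classical
  obtain ⟨S, hS, hmax⟩ := Finset.exists_max_image
    (Finset.univ.filter fun S : Finset M => ∀ p ∈ S, ∀ q ∈ S, p ≠ q → a < dist p q)
    Finset.card ⟨∅, by simp⟩
  simp only [Finset.mem_filter, Finset.mem_univ, true_and] at hS hmax
  refine ⟨S, hS, fun x => ?_⟩
  by_contra! hx
  have hxS : x ∉ S := fun hxS => (hx x hxS).not_ge (by simpa using ha)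
  have := hmax (insert x S) fun p hp q hq hpq => by
    rcases Finset.mem_insert.1 hp with rfl | hpS <;>
      rcases Finset.mem_insert.1 hq with rfl | hqS
    · exact absurd rfl hpq
    · exact hx q hqS
    · rw [dist_comm]; exact hx p hpS
    · exact hS p hpS q hqS hpq
  rw [Finset.card_insert_of_notMem hxS] at this
  omega

/-- A doubling space is covered, at every scale `R`, by boundedly many families of
`δ R`-balls whose centres are `4 R`-separated within each family. -/
theorem IsDoubling.exists_colored_net {M : Type*} [MetricSpace M] [Fintype M] {lam : ℝ}
    (h : IsDoubling M lam) (hlam : 0 ≤ lam) {δ : ℝ} (hδ : 0 < δ) {n K : ℕ}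
    (hn : 8 ≤ δ * 2 ^ n) (hK : lam ^ n < K) {R : ℝ} (hR : 0 < R) :
    ∃ N : Fin K → Set M, (∀ x, ∃ c, ∃ p ∈ N c, dist x p ≤ δ * R) ∧
      ∀ c, ∀ p ∈ N c, ∀ q ∈ N c, p ≠ q → 4 * R < dist p q := by
  classical
  obtain ⟨S, hsep, hcov⟩ := exists_finset_net M (a := δ * R) (by positivity)
  have hK0 : 0 < K := by
    have : (0 : ℝ) < K := (pow_nonneg hlam n).trans_lt hK
    exact_mod_cast this
  obtain ⟨χ, hχ⟩ := exists_coloring_of_card_lt (fun p q : M => dist p q ≤ 4 * R)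
    (fun p q hpq => by rwa [dist_comm]) hK0 S (fun p hp => by
      have := h.card_le_of_separated_s12 hlam n p (r := 4 * R) (a := δ * R) (by positivity)
        (by nlinarith) (S.filter fun q => dist p q ≤ 4 * R)
        (fun y hy => (Finset.mem_filter.1 hy).2)
        (fun y hy z hz => hsep y (Finset.mem_filter.1 hy).1 z (Finset.mem_filter.1 hz).1)
      exact_mod_cast this.trans_lt hK)
  refine ⟨fun c => {p | p ∈ S ∧ χ p = c}, fun x => ?_, ?_⟩
  · obtain ⟨p, hp, hxp⟩ := hcov x
    exact ⟨χ p, p, ⟨hp, rfl⟩, hxp⟩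
  · rintro c p ⟨hp, hpc⟩ q ⟨hq, hqc⟩ hpq
    by_contra! hd
    exact hχ p hp q hq hpq hd (hpc.trans hqc.symm)

/-- The multi-scale sum is dominated by the terms of the two scales nearest to `t`. -/
theorem sum_min_geometric_le {s t B : ℝ} (hs : 0 < s) (ht : 0 < t) (hB : 1 < B) (L : ℕ) :
    ∑ k ∈ Finset.range L, min (s * B ^ k) (t ^ 2 / (s * B ^ k)) ≤ (B + 1) / (B - 1) * t := by
  have hB1 : 0 < B - 1 := by linarith
  have hB0 : 0 < B := by linarith
  have key : ∑ k ∈ Finset.range L, min (s * B ^ k) (t ^ 2 / (s * B ^ k)) ≤ s * B ^ L / (B - 1) ∧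
      (t ≤ s * B ^ L → ∑ k ∈ Finset.range L, min (s * B ^ k) (t ^ 2 / (s * B ^ k)) ≤
        ((B + 1) * t - t ^ 2 / (s * B ^ L) * B) / (B - 1)) := by
    induction L with
    | zero =>
      refine ⟨by simp; positivity, fun hst => ?_⟩
      simp only [pow_zero, mul_one] at hst ⊢
      rw [Finset.sum_range_zero]
      refine div_nonneg ?_ hB1.le
      have : t ^ 2 / s ≤ t := by
        rw [div_le_iff₀ hs]; nlinarith
      nlinarith
    | succ L ih =>
      obtain ⟨h1, h2⟩ := ih
      rw [Finset.sum_range_succ, pow_succ B L, ← mul_assoc]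
      have hv : 0 < s * B ^ L := by positivity
      set v := s * B ^ L with hvdef
      have hgeom : v / (B - 1) + v = v * B / (B - 1) := by field_simp; ring
      have hfst := add_le_add h1 (min_le_left v (t ^ 2 / v))
      rw [hgeom] at hfst
      refine ⟨hfst, fun htv => ?_⟩
      rcases le_total t v with htv' | htv'
      · refine (add_le_add (h2 htv') (min_le_right _ _)).trans_eq ?_
        field_simp
        ring
      · refine hfst.trans ?_
        gcongr
        have : t ^ 2 / (v * B) * B = t ^ 2 / v := by field_simp
        rw [this, le_sub_iff_add_le, ← le_sub_iff_add_le', div_le_iff₀ hv]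
        nlinarith [mul_nonneg (sub_nonneg.2 htv') (sub_nonneg.2 htv)]
  rcases le_total t (s * B ^ L) with h | h
  · refine (key.2 h).trans ?_
    rw [div_mul_eq_mul_div (B + 1)]
    refine div_le_div_of_nonneg_right ?_ hB1.le
    have : 0 ≤ t ^ 2 / (s * B ^ L) * B := by positivity
    linarith
  · refine key.1.trans ?_
    rw [div_mul_eq_mul_div (B + 1)]
    refine div_le_div_of_nonneg_right ?_ hB1.le
    nlinarith

/-- The distance to `N`, truncated at `s ^ 2` and divided by `s`. -/
noncomputable def truncDist {M : Type*} [MetricSpace M] (N : Set M) (s : ℝ) (x : M) : ℝ :=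
  min s (Metric.infDist x N / s)

theorem abs_truncDist_sub_le {M : Type*} [MetricSpace M] (N : Set M) {s : ℝ} (hs : 0 < s)
    (x y : M) : |truncDist N s x - truncDist N s y| ≤ min s (dist x y / s) := by
  have h0 : ∀ z, 0 ≤ truncDist N s z := fun z =>
    le_min hs.le (div_nonneg Metric.infDist_nonneg hs.le)
  have h1 : ∀ z, truncDist N s z ≤ s := fun z => min_le_left _ _
  have h2 : ∀ z w, truncDist N s z ≤ truncDist N s w + dist z w / s := fun z w => by
    have hd : 0 ≤ dist z w / s := by positivity
    have hle : Metric.infDist z N / s ≤ Metric.infDist w N / s + dist z w / s := by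
      rw [← add_div]
      gcongr
      exact Metric.infDist_le_infDist_add_dist
    unfold truncDist
    rw [← min_add_add_right]
    exact min_le_min (by linarith) hle
  rw [abs_sub_le_iff]
  have h3 := h2 y x
  rw [dist_comm y x] at h3
  constructor <;> refine le_min ?_ ?_ <;> linarith [h0 x, h0 y, h1 x, h1 y, h2 x y]

theorem le_truncDist_sub {M : Type*} [MetricSpace M] {N : Set M} {s δ : ℝ} (hs : 0 < s)
    (hδ : 0 ≤ δ) (hδ' : δ ≤ 1 / 16) {p x y : M} (hp : p ∈ N)
    (hN : ∀ q ∈ N, p ≠ q → 4 * s ^ 2 < dist p q)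
    (hxp : dist x p ≤ δ * s ^ 2) (hxy : s ^ 2 ≤ dist x y)
    (hxy' : dist x y ≤ ((1 + δ) * s) ^ 2) :
    (1 - 2 * δ) * s ≤ truncDist N s y - truncDist N s x := by
  have hx : truncDist N s x ≤ δ * s := by
    refine (min_le_right _ _).trans ?_
    rw [div_le_iff₀ hs]
    nlinarith [Metric.infDist_le_dist_of_mem (x := x) hp]
  have hy : (1 - δ) * s ≤ truncDist N s y := by
    refine le_min (by nlinarith) ?_
    rw [le_div_iff₀ hs, Metric.le_infDist ⟨p, hp⟩]
    intro q hq
    have h1 := dist_triangle x q y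
    rw [dist_comm q y] at h1
    by_cases hpq : p = q
    · subst hpq
      nlinarith
    · have h2 := hN q hq hpq
      have h3 := dist_triangle_left p q x
      have h4 := dist_triangle x y q
      have h5 : ((1 + δ) * s) ^ 2 ≤ 2 * s ^ 2 := by
        rw [mul_pow]
        gcongr
        nlinarith
      nlinarith [sq_nonneg s]
  linarith

theorem exists_scale_bounds (M : Type*) [MetricSpace M] [Finite M] {B : ℝ} (hB : 1 < B) :
    ∃ σ : ℝ, 0 < σ ∧ ∃ L : ℕ, ∀ x y : M, x ≠ y →
      σ ≤ Real.sqrt (dist x y) ∧ Real.sqrt (dist x y) < σ * B ^ L := by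
  obtain ⟨σ, hσ, hσ0⟩ : ∃ σ : ℝ, (∀ x y : M, x ≠ y → σ ≤ Real.sqrt (dist x y)) ∧ 0 < σ := by
    refine Filter.Eventually.exists (f := nhdsWithin (0 : ℝ) (Set.Ioi 0)) ?_
    refine Filter.Eventually.and ?_ self_mem_nhdsWithin
    rw [Filter.eventually_all]
    intro x
    rw [Filter.eventually_all]
    intro y
    by_cases hxy : x = y
    · simp [hxy]
    · have : 0 < Real.sqrt (dist x y) := Real.sqrt_pos.2 (dist_pos.2 hxy)
      filter_upwards [nhdsWithin_le_nhds (Iio_mem_nhds this)] with σ hσ _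
      exact le_of_lt hσ
  refine ⟨σ, hσ0, ?_⟩
  obtain ⟨L, hL⟩ : ∃ L : ℕ, ∀ x y : M, Real.sqrt (dist x y) < σ * B ^ L := by
    refine Filter.Eventually.exists (f := Filter.atTop) ?_
    rw [Filter.eventually_all]
    intro x
    rw [Filter.eventually_all]
    intro y
    exact ((tendsto_pow_atTop_atTop_of_one_lt hB).const_mul_atTop hσ0).eventually_gt_atTop _
  exact ⟨L, fun x y hxy => ⟨hσ x y hxy, hL x y⟩⟩

/-- The embedding, for given numerical parameters. -/
theorem IsDoubling.exists_embedding {M : Type*} [MetricSpace M] [Fintype M] {lam : ℝ}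
    (h : IsDoubling M lam) (hlam : 0 ≤ lam) {δ : ℝ} (hδ : 0 < δ) (hδ' : δ ≤ 1 / 16) {n K m : ℕ}
    (hn : 8 ≤ δ * 2 ^ n) (hK : lam ^ n < K) (hm : 0 < m) :
    ∃ φ : M → (Fin m × Fin K → ℝ), ∀ x y : M,
      (1 - 4 * δ - 2 / ((1 + δ) ^ m - 1)) * Real.sqrt (dist x y) ≤ ‖φ x - φ y‖ ∧
      ‖φ x - φ y‖ ≤ (1 + 2 / ((1 + δ) ^ m - 1)) * Real.sqrt (dist x y) := by
  have hη : 1 < 1 + δ := by linarith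
  have hB : 1 < (1 + δ) ^ m := one_lt_pow₀ hη hm.ne'
  obtain ⟨σ, hσ, L, hL⟩ := exists_scale_bounds M hB
  choose N hNcov hNsep using fun j : ℕ =>
    h.exists_colored_net hlam hδ hn hK (R := (σ * (1 + δ) ^ j) ^ 2) (by positivity)
  set B := (1 + δ) ^ m with hBdef
  have hB1 : 0 < B - 1 := by linarith
  have hBB : (B + 1) / (B - 1) = 1 + 2 / (B - 1) := by field_simp; ring
  let s : ℕ → ℝ := fun j => σ * (1 + δ) ^ j
  have hs : ∀ j, 0 < s j := fun j => by positivity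
  have hsB : ∀ a k, s (a + m * k) = s a * B ^ k := fun a k => by
    simp only [s, hBdef, pow_add, pow_mul, mul_assoc]
  let g : Fin m × Fin K → ℕ → M → ℝ := fun i k =>
    truncDist (N (i.1 + m * k) i.2) (s (i.1 + m * k))
  have hg : ∀ i k x y, |g i k x - g i k y| ≤
      min (s i.1 * B ^ k) (Real.sqrt (dist x y) ^ 2 / (s i.1 * B ^ k)) := fun i k x y => by
    rw [Real.sq_sqrt dist_nonneg, ← hsB]
    exact abs_truncDist_sub_le _ (hs _) x y
  refine ⟨fun x i => ∑ k ∈ Finset.range L, g i k x, fun x y => ?_⟩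
  rcases eq_or_ne x y with rfl | hxy
  · simp
  have ht : 0 < Real.sqrt (dist x y) := Real.sqrt_pos.2 (dist_pos.2 hxy)
  have htd : Real.sqrt (dist x y) ^ 2 = dist x y := Real.sq_sqrt dist_nonneg
  obtain ⟨hσt, htL⟩ := hL x y hxy
  set t := Real.sqrt (dist x y) with htdef
  have hsum : ∀ i : Fin m × Fin K, ∑ k ∈ Finset.range L,
      min (s i.1 * B ^ k) (t ^ 2 / (s i.1 * B ^ k)) ≤ (1 + 2 / (B - 1)) * t := fun i =>
    hBB ▸ sum_min_geometric_le (hs i.1) ht hB L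
  constructor
  · obtain ⟨j, hj, hj'⟩ := exists_nat_pow_near (x := t / σ) ((one_le_div hσ).2 hσt) hη
    rw [le_div_iff₀ hσ, mul_comm] at hj
    rw [div_lt_iff₀ hσ, pow_succ] at hj'
    have hj' : t ≤ (1 + δ) * s j := hj'.le.trans_eq (by simp only [s]; ring)
    have hjL : j / m < L := by
      rw [Nat.div_lt_iff_lt_mul hm, mul_comm]
      have := hj.trans_lt htL
      rw [hBdef, ← pow_mul] at this
      exact (pow_lt_pow_iff_right₀ hη).1 (lt_of_mul_lt_mul_left this hσ.le)
    have hmod : j % m + m * (j / m) = j := Nat.mod_add_div j m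
    obtain ⟨c, p, hp, hxp⟩ := hNcov j x
    set i : Fin m × Fin K := (⟨j % m, Nat.mod_lt j hm⟩, c) with hi
    have hik : (i.1 : ℕ) + m * (j / m) = j := hmod
    have hmain : (1 - 2 * δ) * s j ≤ g i (j / m) y - g i (j / m) x := by
      simp only [g, hik]
      exact le_truncDist_sub (hs j) hδ.le hδ' hp (fun q hq hpq => hNsep j c p hp q hq hpq) hxp
        (htd ▸ pow_le_pow_left₀ (hs j).le hj 2) (htd ▸ pow_le_pow_left₀ ht.le hj' 2)
    have hmem : j / m ∈ Finset.range L := Finset.mem_range.2 hjL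
    have hmin : min (s i.1 * B ^ (j / m)) (t ^ 2 / (s i.1 * B ^ (j / m))) = s j := by
      rw [← hsB, hik, min_eq_left]
      rw [le_div_iff₀ (hs j), ← sq]
      exact pow_le_pow_left₀ (hs j).le hj 2
    have hrest := hsum i
    rw [← Finset.add_sum_erase _ _ hmem, hmin] at hrest
    have hothers : ∑ k ∈ (Finset.range L).erase (j / m), (g i k x - g i k y) ≤
        ∑ k ∈ (Finset.range L).erase (j / m),
          min (s i.1 * B ^ k) (t ^ 2 / (s i.1 * B ^ k)) :=
      Finset.sum_le_sum fun k _ => (le_abs_self _).trans (hg i k x y)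
    have hcoord : ∑ k ∈ Finset.range L, g i k y - ∑ k ∈ Finset.range L, g i k x ≤
        ‖(fun i => ∑ k ∈ Finset.range L, g i k x) - fun i => ∑ k ∈ Finset.range L, g i k y‖ := by
      refine le_trans ?_ (norm_le_pi_norm _ i)
      rw [Pi.sub_apply, Real.norm_eq_abs, abs_sub_comm]
      exact le_abs_self _
    refine le_trans ?_ hcoord
    rw [← Finset.sum_sub_distrib, ← Finset.add_sum_erase _ _ hmem]
    have hneg : ∑ k ∈ (Finset.range L).erase (j / m), (g i k y - g i k x) =
        -∑ k ∈ (Finset.range L).erase (j / m), (g i k x - g i k y) := by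
      rw [← Finset.sum_neg_distrib]
      exact Finset.sum_congr rfl fun k _ => by ring
    have hst : (1 - 2 * δ) * t ≤ (1 - δ) * s j := by nlinarith [hs j]
    rw [hneg]
    linarith
  · refine (pi_norm_le_iff_of_nonneg (by positivity)).2 fun i => ?_
    rw [Pi.sub_apply, Real.norm_eq_abs, ← Finset.sum_sub_distrib]
    exact (Finset.abs_sum_le_sum_abs _ _).trans
      ((Finset.sum_le_sum fun k _ => hg i k x y).trans (hsum i))

/-- Assouad's embedding theorem for the 1/2-snowflake: the target is `ℝ^D` equipped with
the sup-norm (the norm of a Pi type). -/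
theorem stmt12 :
    ∃ c : ℝ, 0 < c ∧
      ∀ (M : Type) [MetricSpace M] [Fintype M] (lam : ℝ),
        IsDoubling M lam → 2 ≤ lam →
        ∀ ε : ℝ, 0 < ε → ε ≤ 1 / 2 →
        ∃ (D : ℕ) (φ : M → (Fin D → ℝ)),
          0 < D ∧ (D : ℝ) ≤ (2 / ε) ^ (c * Real.logb 2 lam) ∧
          ∀ x y : M,
            (1 - ε) * Real.sqrt (dist x y) ≤ ‖φ x - φ y‖ ∧
            ‖φ x - φ y‖ ≤ (1 + ε) * Real.sqrt (dist x y) := by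
  refine ⟨10, by norm_num, fun M _ _ lam h hlam ε hε hε' => ?_⟩
  have hlam0 : 0 < lam := by linarith
  have hq : 4 ≤ 2 / ε := by rw [le_div_iff₀ hε]; linarith
  have hq0 : 0 < 2 / ε := by linarith
  set l := Real.logb 2 lam with hl
  have hl1 : 1 ≤ l := by
    rw [hl, Real.le_logb_iff_rpow_le (by norm_num) hlam0]
    simpa using hlam
  obtain ⟨n, hn, hn'⟩ := exists_nat_pow_near (x := 128 / ε) (y := 2)
    (by rw [one_le_div hε]; linarith) (by norm_num)
  have hn8 : 8 ≤ ε / 8 * 2 ^ n := by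
    rw [div_lt_iff₀ hε, pow_succ] at hn'
    linarith
  have hpow : lam ^ n ≤ (2 / ε) ^ (4 * l) := by
    have h1 : (2 : ℝ) ^ n ≤ (2 / ε) ^ 4 := by
      refine hn.trans ?_
      have : 128 / ε = 64 * (2 / ε) := by ring
      rw [this]
      nlinarith [pow_le_pow_left₀ (by norm_num) hq 3]
    calc lam ^ n = ((2 : ℝ) ^ l) ^ n := by
          rw [hl, Real.rpow_logb (by norm_num) (by norm_num) hlam0]
      _ = ((2 : ℝ) ^ n) ^ l := by
          rw [← Real.rpow_natCast, ← Real.rpow_natCast, ← Real.rpow_mul (by norm_num),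
            ← Real.rpow_mul (by norm_num), mul_comm]
      _ ≤ ((2 / ε) ^ 4) ^ l := Real.rpow_le_rpow (by positivity) h1 (by linarith)
      _ = (2 / ε) ^ (4 * l) := by
          rw [← Real.rpow_natCast, ← Real.rpow_mul hq0.le]
          norm_num
  set K := ⌊lam ^ n⌋₊ + 1 with hKdef
  have hK : lam ^ n < K := by
    rw [hKdef]; push_cast; exact Nat.lt_floor_add_one _
  have hKle : (K : ℝ) ≤ (2 / ε) ^ (5 * l) := by
    have h1 : (K : ℝ) ≤ lam ^ n + 1 := by
      rw [hKdef]; push_cast; gcongr; exact Nat.floor_le (by positivity)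
    have h2 : 1 ≤ (2 / ε) ^ (4 * l) := Real.one_le_rpow (by linarith) (by linarith)
    have h3 : 4 ≤ (2 / ε) ^ l :=
      hq.trans (Real.self_le_rpow_of_one_le (by linarith) hl1)
    have h4 : (2 / ε) ^ (5 * l) = (2 / ε) ^ (4 * l) * (2 / ε) ^ l := by
      rw [← Real.rpow_add hq0]; ring_nf
    rw [h4]
    nlinarith
  set m := ⌈8 * (2 / ε) ^ 2⌉₊ with hmdef
  have hm : 8 * (2 / ε) ^ 2 ≤ m := Nat.le_ceil _
  have hm0 : 0 < m := Nat.ceil_pos.2 (by positivity)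
  have hmle : (m : ℝ) ≤ (2 / ε) ^ (5 * l) := by
    have h1 : (m : ℝ) ≤ 8 * (2 / ε) ^ 2 + 1 := (Nat.ceil_lt_add_one (by positivity)).le
    have h2 : 8 * (2 / ε) ^ 2 + 1 ≤ (2 / ε) ^ 5 := by
      have h3 : (4 : ℝ) ^ 3 ≤ (2 / ε) ^ 3 := pow_le_pow_left₀ (by norm_num) hq 3
      have h4 : (4 : ℝ) ^ 2 ≤ (2 / ε) ^ 2 := pow_le_pow_left₀ (by norm_num) hq 2
      have h5 : (2 / ε) ^ 5 = (2 / ε) ^ 3 * (2 / ε) ^ 2 := by ring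
      rw [h5]
      nlinarith
    refine (h1.trans h2).trans ?_
    rw [← Real.rpow_natCast]
    exact Real.rpow_le_rpow_of_exponent_le (by linarith) (by push_cast; linarith)
  have hB : 4 / ε ≤ (1 + ε / 8) ^ m - 1 := by
    have h1 := one_add_mul_le_pow (a := ε / 8) (by linarith) m
    have h2 : 8 * (2 / ε) ^ 2 * (ε / 8) ≤ m * (ε / 8) := by gcongr
    have h3 : 8 * (2 / ε) ^ 2 * (ε / 8) = 4 / ε := by field_simp; norm_num
    linarith
  have hB' : 2 / ((1 + ε / 8) ^ m - 1) ≤ ε / 2 := by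
    have h4 : 0 < 4 / ε := by positivity
    rw [div_le_iff₀ (h4.trans_le hB)]
    calc (2 : ℝ) = ε / 2 * (4 / ε) := by field_simp; norm_num
      _ ≤ _ := by gcongr
  obtain ⟨φ, hφ⟩ := h.exists_embedding hlam0.le (δ := ε / 8) (by positivity) (by linarith)
    hn8 hK hm0
  refine ⟨m * K, fun x i => φ x (finProdFinEquiv.symm i), by positivity, ?_, fun x y => ?_⟩
  · have : (2 / ε) ^ (10 * l) = (2 / ε) ^ (5 * l) * (2 / ε) ^ (5 * l) := by
      rw [← Real.rpow_add hq0]; ring_nf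
    rw [this]
    push_cast
    gcongr
  · have hnorm : ‖(fun i => φ x (finProdFinEquiv.symm i)) -
        fun i => φ y (finProdFinEquiv.symm i)‖ = ‖φ x - φ y‖ := by
      refine le_antisymm ?_ ?_
      · exact (pi_norm_le_iff_of_nonneg (norm_nonneg _)).2 fun i =>
          norm_le_pi_norm (φ x - φ y) (finProdFinEquiv.symm i)
      · refine (pi_norm_le_iff_of_nonneg (norm_nonneg _)).2 fun i => ?_
        simpa only [Pi.sub_apply, Equiv.symm_apply_apply] using norm_le_pi_norm ((fun i => φ x (finProdFinEquiv.symm i)) -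
          fun i => φ y (finProdFinEquiv.symm i)) (finProdFinEquiv i)
    rw [hnorm]
    have ht := Real.sqrt_nonneg (dist x y)
    refine ⟨le_trans ?_ (hφ x y).1, (hφ x y).2.trans ?_⟩
    · exact mul_le_mul_of_nonneg_right (by linarith) ht
    · exact mul_le_mul_of_nonneg_right (by linarith) ht
end
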